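/- arXiv:0806.3442 — 5 statements merged into one kernel-verified Lean document; each statement's English description precedes it below -/
import Mathlib

section
/- Let q, h, w : ℝ → ℝ be continuous and let x, y, z : ℝ → ℝ³ be C¹ functions satisfying the frame equations ẋ = q y + h z, ẏ = −q x + w z, ż = −h x − w y. Suppose that at time 0 the triple (x(0), y(0), z(0)) is orthonormal with z(0) = x(0) × y(0). Then for every t the triple (x(t), y(t), z(t)) is orthonormal with z(t) = x(t) × y(t), and moreover, setting u^a(t) = w(t) x(t) − h(t) y(t) + q(t) z(t), the frame equations are equivalent to ẋ = u^a × x, ẏ = u^a × y, ż = u^a × z. In particular, the curve-framing model coincides with the steered-particle model ẍ = u^a × ẋ with control u^a = R u expressed in the spatial frame, where R = [x, y, z] and u = (w, −h, q). -/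
open Filter

noncomputable section

/-- Euclidean norm on `ℝ³` (represented as `Fin 3 → ℝ`). -/
def norm3 (v : Fin 3 → ℝ) : ℝ := Real.sqrt (∑ i, v i ^ 2)

/-- Euclidean inner product on `ℝ³`. -/
def inner3 (u v : Fin 3 → ℝ) : ℝ := ∑ i, u i * v i

/-- The cross product on `ℝ³`. -/
def cross3 (u v : Fin 3 → ℝ) : Fin 3 → ℝ := crossProduct u v

theorem norm3_eq_one_iff (v : Fin 3 → ℝ) : norm3 v = 1 ↔ inner3 v v = 1 := by
  simp only [norm3, inner3, Real.sqrt_eq_one, sq]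

/-- Row orthonormality of a `3 × 3` matrix is equivalent to column orthonormality. -/
theorem frame_orthonormal_iff_completeness (x y z : Fin 3 → ℝ) :
    (inner3 x x = 1 ∧ inner3 y y = 1 ∧ inner3 z z = 1 ∧
      inner3 x y = 0 ∧ inner3 x z = 0 ∧ inner3 y z = 0) ↔
    ∀ i j, x i * x j + y i * y j + z i * z j = if i = j then 1 else 0 := by
  have hrows : (inner3 x x = 1 ∧ inner3 y y = 1 ∧ inner3 z z = 1 ∧
      inner3 x y = 0 ∧ inner3 x z = 0 ∧ inner3 y z = 0) ↔
      Matrix.of ![x, y, z] * (Matrix.of ![x, y, z]).transpose = 1 := by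
    simp only [← Matrix.ext_iff, Fin.forall_fin_succ, Matrix.mul_apply, Fin.sum_univ_three, inner3]
    simp [Matrix.one_apply]
    grind
  have hcols : (∀ i j, x i * x j + y i * y j + z i * z j = if i = j then 1 else 0) ↔
      (Matrix.of ![x, y, z]).transpose * Matrix.of ![x, y, z] = 1 := by
    simp [← Matrix.ext_iff, Matrix.mul_apply, Fin.sum_univ_three, Matrix.one_apply]
  rw [hrows, hcols, mul_eq_one_comm]

/-- A triple with unit vectors `x ⊥ y` and `z` is right-handed if its determinant is `1`. -/
theorem eq_cross3_of_inner3_eq_one {x y z : Fin 3 → ℝ} (hx : inner3 x x = 1)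
    (hy : inner3 y y = 1) (hz : inner3 z z = 1) (hxy : inner3 x y = 0)
    (hdet : inner3 z (cross3 x y) = 1) : z = cross3 x y := by
  have hcross : inner3 (cross3 x y) (cross3 x y) = 1 := by
    have hlagrange : inner3 (cross3 x y) (cross3 x y) =
        inner3 x x * inner3 y y - inner3 x y ^ 2 := by
      simp [inner3, cross3, cross_apply, Fin.sum_univ_three]
      ring
    rw [hlagrange, hx, hy, hxy]
    norm_num
  have hdist : ∑ i, (z i - cross3 x y i) ^ 2 = 0 := by
    have hexpand : ∑ i, (z i - cross3 x y i) ^ 2 =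
        inner3 z z - 2 * inner3 z (cross3 x y) + inner3 (cross3 x y) (cross3 x y) := by
      simp only [inner3, Fin.sum_univ_three]
      ring
    rw [hexpand, hz, hdet, hcross]
    norm_num
  ext i
  have hi := (Finset.sum_eq_zero_iff_of_nonneg fun i _ => sq_nonneg _).1 hdist i (Finset.mem_univ i)
  exact sub_eq_zero.1 (pow_eq_zero_iff two_ne_zero |>.1 hi)

theorem cross3_cross3_left (a b c : Fin 3 → ℝ) :
    cross3 (cross3 a b) c = inner3 a c • b - inner3 b c • a := by
  ext i
  fin_cases i <;> simp [inner3, cross3, cross_apply, Fin.sum_univ_three] <;> ring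

/-- For a right-handed orthonormal triple, crossing with `w x - h y + q z` gives the right-hand
sides of the frame equations. -/
theorem cross3_frame {x y z : Fin 3 → ℝ} (hx : inner3 x x = 1) (hy : inner3 y y = 1)
    (hxy : inner3 x y = 0) (hz : z = cross3 x y) (q h w : ℝ) :
    cross3 (w • x - h • y + q • z) x = q • y + h • z ∧
    cross3 (w • x - h • y + q • z) y = -q • x + w • z ∧
    cross3 (w • x - h • y + q • z) z = -h • x - w • y := by
  have hyx : inner3 y x = 0 := by rw [← hxy]; simp only [inner3, mul_comm]
  have hzx : cross3 z x = y := by rw [hz, cross3_cross3_left, hx, hyx]; simp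
  have hzy : cross3 z y = -x := by rw [hz, cross3_cross3_left, hy, hxy]; simp
  have hanti (a b : Fin 3 → ℝ) : cross3 a b = -cross3 b a := (cross_anticomm b a).symm
  have hself (a : Fin 3 → ℝ) : cross3 a a = 0 := cross_self a
  have hlin (a : Fin 3 → ℝ) : cross3 (w • x - h • y + q • z) a =
      w • cross3 x a - h • cross3 y a + q • cross3 z a := by
    simp [cross3]
  refine ⟨?_, ?_, ?_⟩
  · rw [hlin, hself, hanti y x, ← hz, hzx]
    module
  · rw [hlin, hself, ← hz, hzy]
    module
  · rw [hlin, hself, hanti x z, hanti y z, hzx, hzy]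
    module

/-- If `(x, y, z)` is a `C¹` solution of the frame equations
`ẋ = q y + h z`, `ẏ = −q x + w z`, `ż = −h x − w y` with `(x(0), y(0), z(0))` a right-handed
orthonormal triple, then `(x(t), y(t), z(t))` is a right-handed orthonormal triple for all `t`,
and, with `u^a = w x − h y + q z = R u` (where `R = [x, y, z]`, `u = (w, −h, q)`), the frame
equations take the equivalent form `ẋ = u^a × x`, `ẏ = u^a × y`, `ż = u^a × z`. -/
theorem frame_equations_orthonormal_and_cross_form
    (q h w : ℝ → ℝ) (x y z : ℝ → Fin 3 → ℝ)
    (hq : Continuous q) (hh : Continuous h) (hw : Continuous w)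
    (hx : ∀ t, HasDerivAt x (q t • y t + h t • z t) t)
    (hy : ∀ t, HasDerivAt y (-(q t) • x t + w t • z t) t)
    (hz : ∀ t, HasDerivAt z (-(h t) • x t - w t • y t) t)
    (hxn : norm3 (x 0) = 1) (hyn : norm3 (y 0) = 1) (hzn : norm3 (z 0) = 1)
    (hxy : inner3 (x 0) (y 0) = 0) (hxz : inner3 (x 0) (z 0) = 0)
    (hyz : inner3 (y 0) (z 0) = 0)
    (hhand : z 0 = cross3 (x 0) (y 0)) :
    (∀ t, norm3 (x t) = 1 ∧ norm3 (y t) = 1 ∧ norm3 (z t) = 1 ∧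
      inner3 (x t) (y t) = 0 ∧ inner3 (x t) (z t) = 0 ∧ inner3 (y t) (z t) = 0 ∧
      z t = cross3 (x t) (y t)) ∧
    (∀ t,
      HasDerivAt x (cross3 (w t • x t - h t • y t + q t • z t) (x t)) t ∧
      HasDerivAt y (cross3 (w t • x t - h t • y t + q t • z t) (y t)) t ∧
      HasDerivAt z (cross3 (w t • x t - h t • y t + q t • z t) (z t)) t) := by
  have hconst {f : ℝ → ℝ} (hf : ∀ t, HasDerivAt f 0 t) (t : ℝ) : f t = f 0 :=
    is_const_of_deriv_eq_zero (fun s => (hf s).differentiableAt) (fun s => (hf s).deriv) t 0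
  have hxi (t : ℝ) (i : Fin 3) := hasDerivAt_pi.1 (hx t) i
  have hyi (t : ℝ) (i : Fin 3) := hasDerivAt_pi.1 (hy t) i
  have hzi (t : ℝ) (i : Fin 3) := hasDerivAt_pi.1 (hz t) i
  have hgram (t : ℝ) (i j : Fin 3) : x t i * x t j + y t i * y t j + z t i * z t j =
      x 0 i * x 0 j + y 0 i * y 0 j + z 0 i * z 0 j := by
    refine hconst (f := fun t => x t i * x t j + y t i * y t j + z t i * z t j) (fun s => ?_) t
    refine ((((hxi s i).mul (hxi s j)).add ((hyi s i).mul (hyi s j))).add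
      ((hzi s i).mul (hzi s j))).congr_deriv ?_
    simp only [Pi.add_apply, Pi.sub_apply, Pi.smul_apply, smul_eq_mul]
    ring
  have hdet (t : ℝ) : inner3 (z t) (cross3 (x t) (y t)) = inner3 (z 0) (cross3 (x 0) (y 0)) := by
    refine hconst (f := fun t => inner3 (z t) (cross3 (x t) (y t))) (fun s => ?_) t
    have hminor (i j : Fin 3) :=
      ((hxi s i).mul (hyi s j)).sub ((hxi s j).mul (hyi s i))
    have hsum := (((hzi s 0).mul (hminor 1 2)).add ((hzi s 1).mul (hminor 2 0))).add
      ((hzi s 2).mul (hminor 0 1))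
    refine (hsum.congr_deriv ?_).congr_of_eventuallyEq (.of_forall fun r => ?_)
    · simp only [Pi.add_apply, Pi.sub_apply, Pi.mul_apply, Pi.smul_apply, smul_eq_mul]
      ring
    · simp [inner3, cross3, cross_apply, Fin.sum_univ_three]
  rw [norm3_eq_one_iff] at hxn hyn hzn
  have hcomplete := (frame_orthonormal_iff_completeness _ _ _).1 ⟨hxn, hyn, hzn, hxy, hxz, hyz⟩
  have hframe (t : ℝ) : inner3 (x t) (x t) = 1 ∧ inner3 (y t) (y t) = 1 ∧
      inner3 (z t) (z t) = 1 ∧ inner3 (x t) (y t) = 0 ∧ inner3 (x t) (z t) = 0 ∧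
      inner3 (y t) (z t) = 0 ∧ z t = cross3 (x t) (y t) := by
    obtain ⟨hxx, hyy, hzz, hxy', hxz', hyz'⟩ := (frame_orthonormal_iff_completeness _ _ _).2
      fun i j => (hgram t i j).trans (hcomplete i j)
    refine ⟨hxx, hyy, hzz, hxy', hxz', hyz', eq_cross3_of_inner3_eq_one hxx hyy hzz hxy' ?_⟩
    rw [hdet, ← hhand, hzn]
  refine ⟨fun t => by simpa only [norm3_eq_one_iff] using hframe t, fun t => ?_⟩
  obtain ⟨hxx, hyy, -, hxy', -, -, hzt⟩ := hframe t
  obtain ⟨hcx, hcy, hcz⟩ := cross3_frame hxx hyy hxy' hzt (q t) (h t) (w t)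
  rw [hcx, hcy, hcz]
  exact ⟨hx t, hy t, hz t⟩
end
end

section
/- Let N ≥ 1 and let x_1, …, x_N : ℝ → ℝ³ be C¹ functions with ‖x_k(0)‖ = 1 for all k, satisfying the closed-loop dynamics ẋ_k = (x_k × x_av) × x_k, where x_av(t) = (1/N) ∑_{j=1}^N x_j(t). Then ‖x_k(t)‖ = 1 for all t and all k, and the function V(t) = (N/2)(1 − ‖x_av(t)‖²) satisfies V'(t) = − ∑_{k=1}^N ‖x_k(t) × x_av(t)‖² ≤ 0 for all t. -/
open Filter

noncomputable section

open Matrix in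
theorem norm3_sq (v : Fin 3 → ℝ) : norm3 v ^ 2 = v ⬝ᵥ v := by
  rw [norm3, Real.sq_sqrt (Finset.sum_nonneg fun i _ => sq_nonneg (v i))]
  simp only [dotProduct, sq]

open Matrix in
theorem hasDerivAt_norm3_sq {f : ℝ → Fin 3 → ℝ} {f' : Fin 3 → ℝ} {t : ℝ}
    (hf : HasDerivAt f f' t) :
    HasDerivAt (fun s => norm3 (f s) ^ 2) (2 * (f t ⬝ᵥ f')) t := by
  have hcoord := hasDerivAt_pi.1 hf
  simp only [norm3_sq, dotProduct, Finset.mul_sum]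
  refine HasDerivAt.fun_sum fun i _ => ?_
  exact ((hcoord i).mul (hcoord i)).congr_deriv (by ring)

open Matrix in
theorem dotProduct_cross3_cross3_self (u v : Fin 3 → ℝ) :
    u ⬝ᵥ cross3 (cross3 u v) u = 0 := by
  rw [cross3, dot_cross_self]

open Matrix in
theorem dotProduct_cross3_cross3 (u v : Fin 3 → ℝ) :
    v ⬝ᵥ cross3 (cross3 u v) u = norm3 (cross3 u v) ^ 2 := by
  rw [norm3_sq]
  exact triple_product_permutation v (cross3 u v) u

/-- For the closed-loop parallel-formation dynamics
`ẋ_k = (x_k × x_av) × x_k` with unit initial speeds, the speeds remain unitary and the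
synchrony potential `V = (N/2)(1 − ‖x_av‖²)` satisfies
`V' = − ∑_k ‖x_k × x_av‖² ≤ 0`. -/
theorem parallel_formation_lyapunov
    (N : ℕ) (hN : 1 ≤ N)
    (x : Fin N → ℝ → Fin 3 → ℝ)
    (xav : ℝ → Fin 3 → ℝ)
    (hav : ∀ t, xav t = (N : ℝ)⁻¹ • ∑ j, x j t)
    (hinit : ∀ k, norm3 (x k 0) = 1)
    (hdyn : ∀ k t, HasDerivAt (x k) (cross3 (cross3 (x k t) (xav t)) (x k t)) t) :
    (∀ k, ∀ t : ℝ, norm3 (x k t) = 1) ∧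
    (∀ t : ℝ,
      HasDerivAt (fun s => ((N : ℝ) / 2) * (1 - norm3 (xav s) ^ 2))
        (-(∑ k, norm3 (cross3 (x k t) (xav t)) ^ 2)) t ∧
      -(∑ k, norm3 (cross3 (x k t) (xav t)) ^ 2) ≤ 0) := by
  refine ⟨fun k t => ?_, fun t => ⟨?_, ?_⟩⟩
  · have hderiv : ∀ s, HasDerivAt (fun s => norm3 (x k s) ^ 2) 0 s := fun s =>
      (hasDerivAt_norm3_sq (hdyn k s)).congr_deriv (by
        rw [dotProduct_cross3_cross3_self, mul_zero])
    have hconst := is_const_of_deriv_eq_zero (fun s => (hderiv s).differentiableAt)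
      (fun s => (hderiv s).deriv) t 0
    simp only [hinit] at hconst
    exact (sq_eq_sq₀ (Real.sqrt_nonneg _) zero_le_one).1 hconst
  · have hN0 : (N : ℝ) ≠ 0 := by positivity
    have hxav : HasDerivAt xav
        ((N : ℝ)⁻¹ • ∑ j, cross3 (cross3 (x j t) (xav t)) (x j t)) t := by
      have hsum := (HasDerivAt.fun_sum (u := Finset.univ) fun j _ => hdyn j t).fun_const_smul
        (N : ℝ)⁻¹
      exact hsum.congr_of_eventuallyEq (Eventually.of_forall hav)
    refine (((hasDerivAt_norm3_sq hxav).const_sub 1).const_mul ((N : ℝ) / 2)).congr_deriv ?_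
    simp only [dotProduct_smul, dotProduct_sum, dotProduct_cross3_cross3, smul_eq_mul]
    field_simp
  · exact neg_nonpos.2 (Finset.sum_nonneg fun k _ => sq_nonneg _)
end
end

section
/- Let N ≥ 2 and let x_1, …, x_N : [0, ∞) → ℝ³ be C¹ functions with ‖x_k(0)‖ = 1 for all k, satisfying the closed-loop dynamics ẋ_k = (x_k × x_av) × x_k for all t ≥ 0, where x_av(t) = (1/N) ∑_{j=1}^N x_j(t). If ‖x_av(0)‖ > 1 − 2/N, then ‖x_av(t)‖ → 1 as t → ∞ and x_k(t) − x_av(t) → 0 for every k; that is, the velocity vectors asymptotically synchronize and the solution converges to the set of parallel motions. -/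
open Filter

noncomputable section

open scoped Matrix

lemma norm3_eq_sqrt_dotProduct (v : Fin 3 → ℝ) : norm3 v = √(v ⬝ᵥ v) := by
  simp [norm3, dotProduct, sq]

lemma cross3_cross3_self (u m : Fin 3 → ℝ) :
    cross3 (cross3 u m) u = (u ⬝ᵥ u) • m - (m ⬝ᵥ u) • u := by
  ext i
  fin_cases i <;>
    simp [cross3, cross_apply, dotProduct, Fin.sum_univ_three] <;> ring

lemma dotProduct_sq_le {n : Type*} [Fintype n] (u v : n → ℝ) :
    (u ⬝ᵥ v) ^ 2 ≤ (u ⬝ᵥ u) * (v ⬝ᵥ v) := by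
  simpa [dotProduct, sq] using Finset.sum_mul_sq_le_sq_mul_sq Finset.univ u v

lemma HasDerivAt.dotProduct_self {n : Type*} [Fintype n] {u : ℝ → n → ℝ} {u' : n → ℝ} {t : ℝ}
    (hu : HasDerivAt u u' t) : HasDerivAt (fun s => u s ⬝ᵥ u s) (2 * (u t ⬝ᵥ u')) t := by
  have h := HasDerivAt.fun_sum (u := Finset.univ)
    fun i _ => (hasDerivAt_pi.1 hu i).mul (hasDerivAt_pi.1 hu i)
  refine h.congr_deriv ?_
  rw [dotProduct, Finset.mul_sum]
  exact Finset.sum_congr rfl fun i _ => by ring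

lemma monotoneOn_Ici_of_hasDerivAt_nonneg {f f' : ℝ → ℝ} {a : ℝ}
    (hf : ∀ t, a ≤ t → HasDerivAt f (f' t) t) (hf' : ∀ t, a ≤ t → 0 ≤ f' t) :
    MonotoneOn f (Set.Ici a) := by
  refine monotoneOn_of_hasDerivWithinAt_nonneg (convex_Ici a)
    (fun t ht => (hf t ht).continuousAt.continuousWithinAt)
    (fun t ht => (hf t (interior_subset ht)).hasDerivWithinAt)
    (fun t ht => hf' t (interior_subset ht))

/-- A function bounded above by `L` whose derivative is at least `a * (L - f)` with `a > 0`
converges to `L`. -/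
lemma tendsto_of_mul_sub_le_deriv {f f' : ℝ → ℝ} {a L : ℝ} (ha : 0 < a)
    (hf : ∀ t, 0 ≤ t → HasDerivAt f (f' t) t) (hle : ∀ t, 0 ≤ t → f t ≤ L)
    (hf' : ∀ t, 0 ≤ t → a * (L - f t) ≤ f' t) : Tendsto f atTop (nhds L) := by
  have hmono : MonotoneOn (fun t => (f t - L) * Real.exp (a * t)) (Set.Ici 0) := by
    refine monotoneOn_Ici_of_hasDerivAt_nonneg
      (f' := fun t => (f' t - a * (L - f t)) * Real.exp (a * t)) (fun t ht => ?_) fun t ht =>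
        mul_nonneg (sub_nonneg.2 (hf' t ht)) (Real.exp_pos _).le
    have hexp : HasDerivAt (fun t => Real.exp (a * t)) (Real.exp (a * t) * (a * 1)) t :=
      ((hasDerivAt_id t).const_mul a).exp
    exact (((hf t ht).sub_const L).mul hexp).congr_deriv (by ring)
  have hlim : Tendsto (fun t => L + (f 0 - L) * Real.exp (-(a * t))) atTop (nhds L) := by
    have h := Real.tendsto_exp_neg_atTop_nhds_zero.comp (tendsto_id.const_mul_atTop ha)
    simpa using (h.const_mul (f 0 - L)).const_add L
  refine tendsto_of_tendsto_of_tendsto_of_le_of_le' hlim tendsto_const_nhds ?_ ?_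
  · filter_upwards [eventually_ge_atTop 0] with t ht
    have h := hmono Set.self_mem_Ici ht ht
    simp only [mul_zero, Real.exp_zero, mul_one] at h
    have h2 := mul_le_mul_of_nonneg_right h (Real.exp_pos (-(a * t))).le
    rw [mul_assoc, ← Real.exp_add, add_neg_cancel, Real.exp_zero, mul_one] at h2
    linarith
  · filter_upwards [eventually_ge_atTop 0] with t ht using hle t ht

lemma sum_dotProduct_sub_self {N : ℕ} (hN : 0 < N) {v : Fin N → Fin 3 → ℝ} {m : Fin 3 → ℝ}
    (hm : m = (N : ℝ)⁻¹ • ∑ j, v j) (hv : ∀ k, v k ⬝ᵥ v k = 1) :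
    ∑ k, (v k - m) ⬝ᵥ (v k - m) = N * (1 - m ⬝ᵥ m) := by
  have hN' : (N : ℝ) ≠ 0 := by positivity
  have hsum : ∑ j, v j = (N : ℝ) • m := by rw [hm, smul_inv_smul₀ hN']
  have hc : ∑ k, m ⬝ᵥ v k = N * (m ⬝ᵥ m) := by
    rw [← dotProduct_sum, hsum, dotProduct_smul, smul_eq_mul]
  have h : ∀ k, (v k - m) ⬝ᵥ (v k - m) = 1 - 2 * (m ⬝ᵥ v k) + m ⬝ᵥ m := fun k => by
    rw [sub_dotProduct, dotProduct_sub, dotProduct_sub, hv, dotProduct_comm (v k) m]; ring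
  simp only [h, Finset.sum_add_distrib, Finset.sum_sub_distrib, ← Finset.mul_sum, hc]
  simp
  ring

lemma two_sub_mul_one_sub_pos {n ρ : ℝ} (hn : 0 < n) (hρ : 1 - 2 / n < ρ) :
    0 < 2 - n * (1 - ρ) := by
  have h : n * (1 - ρ) < n * (2 / n) := by gcongr; linarith
  rw [mul_div_cancel₀ _ hn.ne'] at h
  linarith

/-- If the mean `m` of `N` unit vectors has length at least `ρ > 0`, `ρ > 1 - 2 / N`, then the rate of increase of
`‖m‖²` along the synchronizing flow is bounded below by a multiple of `1 - ‖m‖²`. -/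
lemma mul_one_sub_le_sum_sub_sq {N : ℕ} (hN : 0 < N) {v : Fin N → Fin 3 → ℝ} {m : Fin 3 → ℝ}
    (hm : m = (N : ℝ)⁻¹ • ∑ j, v j) (hv : ∀ k, v k ⬝ᵥ v k = 1) {ρ : ℝ} (hρ : 0 < ρ)
    (hρN : 1 - 2 / (N : ℝ) < ρ) (hρm : ρ ^ 2 ≤ m ⬝ᵥ m) :
    ρ ^ 2 * (2 - N * (1 - ρ)) * (1 - m ⬝ᵥ m) ≤
      2 * (N : ℝ)⁻¹ * ∑ k, (m ⬝ᵥ m - (m ⬝ᵥ v k) ^ 2) := by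
  have hN' : (0 : ℝ) < N := by positivity
  have hsum : ∑ j, v j = (N : ℝ) • m := by rw [hm, smul_inv_smul₀ hN'.ne']
  have hc : ∑ k, m ⬝ᵥ v k = N * (m ⬝ᵥ m) := by
    rw [← dotProduct_sum, hsum, dotProduct_smul, smul_eq_mul]
  have hδ : 0 < 2 - N * (1 - ρ) := two_sub_mul_one_sub_pos hN' hρN
  have hCS : ∀ k, (m ⬝ᵥ v k) ^ 2 ≤ m ⬝ᵥ m := fun k => by
    simpa [hv] using dotProduct_sq_le m (v k)
  obtain ⟨r, hr, hrR⟩ : ∃ r, ρ ≤ r ∧ m ⬝ᵥ m = r ^ 2 :=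
    ⟨√(m ⬝ᵥ m), Real.le_sqrt_of_sq_le hρm,
      (Real.sq_sqrt (le_trans (sq_nonneg ρ) hρm)).symm⟩
  rw [hrR] at hc hCS ⊢
  have hr0 : 0 < r := hρ.trans_le hr
  have hle : ∀ k, 0 ≤ r - m ⬝ᵥ v k := fun k =>
    sub_nonneg.2 (le_of_abs_le (abs_le_of_sq_le_sq (hCS k) hr0.le))
  have hgap : ∑ k, (r - m ⬝ᵥ v k) = N * (r * (1 - r)) := by
    rw [Finset.sum_sub_distrib, hc]; simp; ring
  have hr1 : 0 ≤ 1 - r := by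
    have h : 0 ≤ N * (r * (1 - r)) := hgap ▸ Finset.sum_nonneg fun k _ => hle k
    exact nonneg_of_mul_nonneg_right (nonneg_of_mul_nonneg_right h hN') hr0
  have hplus : ∀ k, ρ * (2 - N * (1 - ρ)) ≤ r + m ⬝ᵥ v k := fun k => by
    have h1 : r - m ⬝ᵥ v k ≤ N * (r * (1 - r)) :=
      hgap ▸ Finset.single_le_sum (f := fun k => r - m ⬝ᵥ v k) (fun j _ => hle j)
        (Finset.mem_univ k)
    have h2 : ρ * (2 - N * (1 - ρ)) ≤ r * (2 - N * (1 - r)) := by gcongr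
    linarith
  have hS : ρ * (2 - N * (1 - ρ)) * (N * (r * (1 - r))) ≤ ∑ k, (r ^ 2 - (m ⬝ᵥ v k) ^ 2) := by
    rw [← hgap, Finset.mul_sum]
    refine Finset.sum_le_sum fun k _ => ?_
    have := mul_le_mul_of_nonneg_right (hplus k) (hle k)
    linarith
  calc ρ ^ 2 * (2 - N * (1 - ρ)) * (1 - r ^ 2)
      = ρ * (2 - N * (1 - ρ)) * (1 - r) * (ρ * (1 + r)) := by ring
    _ ≤ ρ * (2 - N * (1 - ρ)) * (1 - r) * (2 * r) := by
        refine mul_le_mul_of_nonneg_left ?_ (by positivity)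
        nlinarith
    _ = 2 * (N : ℝ)⁻¹ * (ρ * (2 - N * (1 - ρ)) * (N * (r * (1 - r)))) := by
        field_simp
    _ ≤ _ := by gcongr

/-- For the closed-loop parallel-formation dynamics
`ẋ_k = (x_k × x_av) × x_k` on `[0, ∞)` with unit initial speeds, if `‖x_av(0)‖ > 1 − 2/N`
then `‖x_av(t)‖ → 1` and `x_k(t) − x_av(t) → 0` for every `k`: the velocity vectors
asymptotically synchronize and the solution converges to the set of parallel motions. -/
theorem parallel_formation_synchronization
    (N : ℕ) (hN : 2 ≤ N)
    (x : Fin N → ℝ → Fin 3 → ℝ)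
    (xav : ℝ → Fin 3 → ℝ)
    (hav : ∀ t, xav t = (N : ℝ)⁻¹ • ∑ j, x j t)
    (hinit : ∀ k, norm3 (x k 0) = 1)
    (hdyn : ∀ k, ∀ t : ℝ, 0 ≤ t →
      HasDerivAt (x k) (cross3 (cross3 (x k t) (xav t)) (x k t)) t)
    (hlevel : 1 - 2 / (N : ℝ) < norm3 (xav 0)) :
    Tendsto (fun t => norm3 (xav t)) atTop (nhds 1) ∧
    (∀ k, Tendsto (fun t => x k t - xav t) atTop (nhds 0)) := by
  have hN0 : 0 < N := by omega
  have hN' : (0 : ℝ) < N := by positivity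
  have hunit : ∀ k t, 0 ≤ t → x k t ⬝ᵥ x k t = 1 := by
    intro k t ht
    have hd : ∀ s, 0 ≤ s → HasDerivAt (fun s => x k s ⬝ᵥ x k s) 0 s := fun s hs => by
      refine (hdyn k s hs).dotProduct_self.congr_deriv ?_
      rw [cross3_cross3_self, dotProduct_sub, dotProduct_smul, dotProduct_smul,
        dotProduct_comm (x k s) (xav s), smul_eq_mul, smul_eq_mul]
      ring
    have h0 : x k 0 ⬝ᵥ x k 0 = 1 := by
      rw [← Real.sqrt_eq_one, ← norm3_eq_sqrt_dotProduct, hinit]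
    have hle := monotoneOn_Ici_of_hasDerivAt_nonneg hd (fun _ _ => le_rfl) Set.self_mem_Ici ht ht
    have hge := monotoneOn_Ici_of_hasDerivAt_nonneg (fun s hs => (hd s hs).neg)
      (fun _ _ => neg_zero.ge) Set.self_mem_Ici ht ht
    simp only [Pi.neg_apply] at hle hge
    linarith
  have hderiv : ∀ t, 0 ≤ t → HasDerivAt (fun s => xav s ⬝ᵥ xav s)
      (2 * (N : ℝ)⁻¹ * ∑ k, (xav t ⬝ᵥ xav t - (xav t ⬝ᵥ x k t) ^ 2)) t := by
    intro t ht
    have h : HasDerivAt xav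
        ((N : ℝ)⁻¹ • ∑ k, cross3 (cross3 (x k t) (xav t)) (x k t)) t := by
      have hsum := HasDerivAt.fun_sum (u := Finset.univ) fun k _ => hdyn k t ht
      exact (hsum.const_smul (N : ℝ)⁻¹).congr_of_eventuallyEq (.of_forall hav)
    refine h.dotProduct_self.congr_deriv ?_
    rw [dotProduct_smul, dotProduct_sum, smul_eq_mul, mul_assoc]
    congr 2
    refine Finset.sum_congr rfl fun k _ => ?_
    rw [cross3_cross3_self, hunit k t ht, one_smul, dotProduct_sub, dotProduct_smul, smul_eq_mul,
      sq]
  have hmono : MonotoneOn (fun s => xav s ⬝ᵥ xav s) (Set.Ici 0) := by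
    refine monotoneOn_Ici_of_hasDerivAt_nonneg hderiv fun t ht => ?_
    refine mul_nonneg (by positivity) (Finset.sum_nonneg fun k _ => sub_nonneg.2 ?_)
    simpa [hunit k t ht] using dotProduct_sq_le (xav t) (x k t)
  have hspread : ∀ t, 0 ≤ t →
      ∑ k, (x k t - xav t) ⬝ᵥ (x k t - xav t) = N * (1 - xav t ⬝ᵥ xav t) := fun t ht =>
    sum_dotProduct_sub_self hN0 (hav t) fun k => hunit k t ht
  have hself : ∀ v : Fin 3 → ℝ, 0 ≤ v ⬝ᵥ v := fun v =>
    Finset.sum_nonneg fun i _ => mul_self_nonneg _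
  have hle1 : ∀ t, 0 ≤ t → xav t ⬝ᵥ xav t ≤ 1 := fun t ht => by
    have h : 0 ≤ N * (1 - xav t ⬝ᵥ xav t) :=
      hspread t ht ▸ Finset.sum_nonneg fun k _ => hself _
    linarith [nonneg_of_mul_nonneg_right h hN']
  have hN2 : 2 / (N : ℝ) ≤ 1 := by
    rw [div_le_one hN']
    exact_mod_cast hN
  have hρ : 0 < norm3 (xav 0) := by linarith
  have hδ : 0 < 2 - N * (1 - norm3 (xav 0)) := two_sub_mul_one_sub_pos hN' hlevel
  have hlim : Tendsto (fun t => xav t ⬝ᵥ xav t) atTop (nhds 1) := by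
    refine tendsto_of_mul_sub_le_deriv (mul_pos (pow_pos hρ 2) hδ) hderiv hle1 fun t ht => ?_
    refine mul_one_sub_le_sum_sub_sq hN0 (hav t) (fun k => hunit k t ht) hρ hlevel ?_
    rw [norm3_eq_sqrt_dotProduct, Real.sq_sqrt (hself _)]
    exact hmono Set.self_mem_Ici ht ht
  refine ⟨by simpa [norm3_eq_sqrt_dotProduct] using hlim.sqrt, fun k => ?_⟩
  have hbound : Tendsto (fun t => √(N * (1 - xav t ⬝ᵥ xav t))) atTop (nhds 0) := by
    simpa using ((hlim.const_sub 1).const_mul (N : ℝ)).sqrt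
  refine squeeze_zero_norm' ?_ hbound
  filter_upwards [eventually_ge_atTop 0] with t ht
  refine (pi_norm_le_iff_of_nonneg (Real.sqrt_nonneg _)).2 fun i => Real.abs_le_sqrt ?_
  rw [← hspread t ht, sq]
  calc _ ≤ (x k t - xav t) ⬝ᵥ (x k t - xav t) :=
        Finset.single_le_sum (f := fun i => (x k t - xav t) i * (x k t - xav t) i)
          (fun j _ => mul_self_nonneg _) (Finset.mem_univ i)
    _ ≤ _ := Finset.single_le_sum (f := fun k => (x k t - xav t) ⬝ᵥ (x k t - xav t))
          (fun j _ => hself _) (Finset.mem_univ k)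
end
end

section
/- Fix ω₀ ∈ ℝ³ and let r_1, …, r_N, x_1, …, x_N : [0, ∞) → ℝ³ be C¹ functions with ‖x_k(t)‖ = 1 for all t ≥ 0 and all k, satisfying ṙ_k = x_k and ẋ_k = u_k^a × x_k with the control u_k^a = ω₀ + [(r_k − r_av) × ω₀ − x_av] × x_k, where r_av = (1/N) ∑_j r_j and x_av = (1/N) ∑_j x_j. Define v_k = x_k + r_k × ω₀ and v_av = (1/N) ∑_j v_j. Then for every k, (v_k(t) − v_av(t)) × x_k(t) → 0 as t → ∞; that is, every solution asymptotically converges to the set where, for each k, v_k − v_av is parallel to x_k. -/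
open Filter

noncomputable section

open Matrix

/-- A form of Barbalat's lemma: if `S` is bounded below with `S' ≤ -G ≤ 0` and `G` has bounded
derivative on `[0, ∞)`, then `G` tends to zero. -/
theorem tendsto_zero_of_hasDerivAt_le_neg {S S' G G' : ℝ → ℝ} {C : ℝ}
    (hS : ∀ t, 0 ≤ t → HasDerivAt S (S' t) t) (hS0 : ∀ t, 0 ≤ t → 0 ≤ S t)
    (hSG : ∀ t, 0 ≤ t → S' t ≤ -G t) (hG0 : ∀ t, 0 ≤ t → 0 ≤ G t)
    (hG : ∀ t, 0 ≤ t → HasDerivAt G (G' t) t) (hC : ∀ t, 0 ≤ t → |G' t| ≤ C) :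
    Tendsto G atTop (nhds 0) := by
  have growth : ∀ t h c : ℝ, 0 ≤ t → 0 ≤ h → (∀ s, t ≤ s → s ≤ t + h → c ≤ G s) →
      S (t + h) ≤ S t - c * h := by
    intro t h c ht hh hc
    have key := (convex_Icc t (t + h)).image_sub_le_mul_sub_of_deriv_le (f := S) (C := -c)
      (fun s hs => (hS s (ht.trans hs.1)).continuousAt.continuousWithinAt)
      (fun s hs => (hS s (ht.trans (interior_subset hs).1)).differentiableAt.differentiableWithinAt)
      (fun s hs => by
        have hs := interior_subset hs
        rw [(hS s (ht.trans hs.1)).deriv]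
        linarith [hSG s (ht.trans hs.1), hc s hs.1 hs.2])
      t (Set.left_mem_Icc.2 (by linarith)) (t + h) (Set.right_mem_Icc.2 (by linarith))
      (by linarith)
    linarith
  have lipschitz : ∀ t s : ℝ, 0 ≤ t → t ≤ s → G t - C * (s - t) ≤ G s := by
    intro t s ht hts
    have key := (convex_Icc t s).mul_sub_le_image_sub_of_le_deriv (f := G) (C := -C)
      (fun s hs => (hG s (ht.trans hs.1)).continuousAt.continuousWithinAt)
      (fun s hs => (hG s (ht.trans (interior_subset hs).1)).differentiableAt.differentiableWithinAt)
      (fun s hs => by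
        have hs := interior_subset hs
        rw [(hG s (ht.trans hs.1)).deriv]
        exact (abs_le.1 (hC s (ht.trans hs.1))).1)
      t (Set.left_mem_Icc.2 hts) s (Set.right_mem_Icc.2 hts) hts
    linarith
  have anti : ∀ t s : ℝ, 0 ≤ t → t ≤ s → S s ≤ S t := by
    intro t s ht hts
    have := growth t (s - t) 0 ht (by linarith) fun u hu _ => hG0 u (ht.trans hu)
    simpa using this
  have hCnonneg : 0 ≤ C := (abs_nonneg _).trans (hC 0 le_rfl)
  rw [Metric.tendsto_atTop]
  intro ε hε
  set h := ε / (2 * (C + 1)) with hh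
  have hpos : 0 < h := by positivity
  have hCh : C * h < ε / 2 := by
    have : (C + 1) * h = ε / 2 := by rw [hh]; field_simp
    linarith
  have hbdd : BddBelow (S '' Set.Ici 0) := ⟨0, by rintro _ ⟨t, ht, rfl⟩; exact hS0 t ht⟩
  obtain ⟨_, ⟨T, hT, rfl⟩, hlt⟩ := exists_lt_of_csInf_lt (s := S '' Set.Ici 0)
    ⟨S 0, 0, Set.self_mem_Ici, rfl⟩
    (lt_add_of_pos_right (sInf (S '' Set.Ici 0)) (by positivity : 0 < ε / 2 * h))
  refine ⟨T, fun t hTt => ?_⟩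
  have ht : 0 ≤ t := le_trans hT hTt
  have hinf : sInf (S '' Set.Ici 0) ≤ S (t + h) :=
    csInf_le hbdd ⟨t + h, by simp only [Set.mem_Ici]; linarith, rfl⟩
  have hdrop := growth t h (G t - C * h) ht hpos.le fun s hts hsh => by
    have := lipschitz t s ht hts
    nlinarith
  have : (G t - C * h) * h < ε / 2 * h := by linarith [anti T t hT hTt]
  rw [Real.dist_eq, sub_zero, abs_of_nonneg (hG0 t ht)]
  linarith [lt_of_mul_lt_mul_right this hpos.le]

theorem cross3_add_left (a b c : Fin 3 → ℝ) : cross3 (a + b) c = cross3 a c + cross3 b c := by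
  simp [cross3]

theorem cross3_sub_left (a b c : Fin 3 → ℝ) : cross3 (a - b) c = cross3 a c - cross3 b c := by
  simp [cross3]

theorem cross3_smul_sum_left {ι : Type*} [Fintype ι] (c : ℝ) (a : ι → Fin 3 → ℝ)
    (b : Fin 3 → ℝ) : cross3 (c • ∑ j, a j) b = c • ∑ j, cross3 (a j) b := by
  simp [cross3]

theorem norm_cross3_le (a b : Fin 3 → ℝ) : ‖cross3 a b‖ ≤ 2 * ‖a‖ * ‖b‖ := by
  have h : ∀ i j, |a i * b j| ≤ ‖a‖ * ‖b‖ := fun i j => by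
    rw [abs_mul]
    exact mul_le_mul (norm_le_pi_norm a i) (norm_le_pi_norm b j) (abs_nonneg _) (norm_nonneg _)
  have h₂ : ∀ i j k l, |a i * b j - a k * b l| ≤ 2 * ‖a‖ * ‖b‖ := fun i j k l => by
    linarith [abs_sub (a i * b j) (a k * b l), h i j, h k l]
  refine (pi_norm_le_iff_of_nonneg (by positivity)).2 fun i => ?_
  fin_cases i <;> simpa [cross3, cross_apply] using h₂ _ _ _ _

theorem abs_dotProduct_le (a b : Fin 3 → ℝ) : |a ⬝ᵥ b| ≤ 3 * ‖a‖ * ‖b‖ := by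
  have h : ∀ i, |a i * b i| ≤ ‖a‖ * ‖b‖ := fun i => by
    rw [abs_mul]
    exact mul_le_mul (norm_le_pi_norm a i) (norm_le_pi_norm b i) (abs_nonneg _) (norm_nonneg _)
  calc |a ⬝ᵥ b| ≤ ∑ i, |a i * b i| := Finset.abs_sum_le_sum_abs _ _
    _ ≤ ∑ _i : Fin 3, ‖a‖ * ‖b‖ := Finset.sum_le_sum fun i _ => h i
    _ = 3 * ‖a‖ * ‖b‖ := by simp; ring

theorem dotProduct_self_nonneg_real (a : Fin 3 → ℝ) : 0 ≤ a ⬝ᵥ a :=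
  Finset.sum_nonneg fun i _ => mul_self_nonneg (a i)

theorem norm_le_sqrt_dotProduct_self (a : Fin 3 → ℝ) : ‖a‖ ≤ √(a ⬝ᵥ a) := by
  refine (pi_norm_le_iff_of_nonneg (Real.sqrt_nonneg _)).2 fun i => Real.abs_le_sqrt ?_
  rw [sq]
  exact Finset.single_le_sum (f := fun i => a i * a i) (fun j _ => mul_self_nonneg (a j))
    (Finset.mem_univ i)

theorem dotProduct_cross3_cross3_s11 (a b : Fin 3 → ℝ) :
    a ⬝ᵥ cross3 (cross3 a b) b = -(cross3 a b ⬝ᵥ cross3 a b) := by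
  simp [cross3, cross_apply, dotProduct, Fin.sum_univ_three]
  ring

theorem HasDerivAt.cross3 {a b : ℝ → Fin 3 → ℝ} {a' b' : Fin 3 → ℝ} {t : ℝ}
    (ha : HasDerivAt a a' t) (hb : HasDerivAt b b' t) :
    HasDerivAt (fun s => _root_.cross3 (a s) (b s))
      (_root_.cross3 a' (b t) + _root_.cross3 (a t) b') t := by
  rw [hasDerivAt_pi] at ha hb ⊢
  intro i
  have h : ∀ i j k l, HasDerivAt (fun s => a s i * b s j - a s k * b s l)
      ((a' i * b t j + a t i * b' j) - (a' k * b t l + a t k * b' l)) t := fun i j k l =>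
    ((ha i).mul (hb j)).sub ((ha k).mul (hb l))
  fin_cases i <;> simp only [_root_.cross3, cross_apply]
  · exact (h 1 2 2 1).congr_deriv (by simp; ring)
  · exact (h 2 0 0 2).congr_deriv (by simp; ring)
  · exact (h 0 1 1 0).congr_deriv (by simp; ring)

theorem HasDerivAt.dotProduct_self_s11 {a : ℝ → Fin 3 → ℝ} {a' : Fin 3 → ℝ} {t : ℝ}
    (ha : HasDerivAt a a' t) : HasDerivAt (fun s => a s ⬝ᵥ a s) (2 * (a t ⬝ᵥ a')) t := by
  rw [hasDerivAt_pi] at ha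
  have h := HasDerivAt.fun_sum (u := Finset.univ) fun i _ => (ha i).mul (ha i)
  refine h.congr_deriv ?_
  simp only [dotProduct, Finset.mul_sum]
  exact Finset.sum_congr rfl fun i _ => by ring

/-- Along the closed-loop screw-formation dynamics with control
`u_k^a = ω₀ + [(r_k − r_av) × ω₀ − x_av] × x_k` on `[0, ∞)`, the spatial twist components
`v_k = x_k + r_k × ω₀` satisfy `(v_k(t) − v_av(t)) × x_k(t) → 0` as `t → ∞`: every solution
converges to the set where each `v_k − v_av` is parallel to `x_k`. -/
theorem screw_formation_convergence
    (N : ℕ) (hN : 1 ≤ N) (ω₀ : Fin 3 → ℝ)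
    (r x : Fin N → ℝ → Fin 3 → ℝ)
    (rav xav : ℝ → Fin 3 → ℝ)
    (hrav : ∀ t, rav t = (N : ℝ)⁻¹ • ∑ j, r j t)
    (hxav : ∀ t, xav t = (N : ℝ)⁻¹ • ∑ j, x j t)
    (hunit : ∀ k, ∀ t : ℝ, 0 ≤ t → norm3 (x k t) = 1)
    (hr : ∀ k, ∀ t : ℝ, 0 ≤ t → HasDerivAt (r k) (x k t) t)
    (hx : ∀ k, ∀ t : ℝ, 0 ≤ t → HasDerivAt (x k)
      (cross3 (ω₀ + cross3 (cross3 (r k t - rav t) ω₀ - xav t) (x k t)) (x k t)) t)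
    (v : Fin N → ℝ → Fin 3 → ℝ)
    (hv : ∀ k t, v k t = x k t + cross3 (r k t) ω₀)
    (vav : ℝ → Fin 3 → ℝ)
    (hvav : ∀ t, vav t = (N : ℝ)⁻¹ • ∑ j, v j t) :
    ∀ k, Tendsto (fun t => cross3 (v k t - vav t) (x k t)) atTop (nhds 0) := by
  have hNne : (N : ℝ) ≠ 0 := by positivity
  set w : Fin N → ℝ → Fin 3 → ℝ := fun k t => v k t - vav t with hw
  set p : Fin N → ℝ → Fin 3 → ℝ := fun k t => cross3 (cross3 (w k t) (x k t)) (x k t) with hp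
  have hxself : ∀ k, ∀ t : ℝ, 0 ≤ t → x k t ⬝ᵥ x k t = 1 := fun k t ht => by
    have := hunit k t ht
    rw [norm3, Real.sqrt_eq_one] at this
    simpa [dotProduct, sq] using this
  have hvav_eq : ∀ t, vav t = xav t + cross3 (rav t) ω₀ := fun t => by
    rw [hvav, hxav, hrav, cross3_smul_sum_left, ← smul_add, ← Finset.sum_add_distrib]
    simp only [hv]
  have hx' : ∀ k, ∀ t : ℝ, 0 ≤ t → HasDerivAt (x k) (cross3 ω₀ (x k t) + p k t) t :=
    fun k t ht => by
      convert hx k t ht using 1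
      have hfeedback : cross3 (r k t - rav t) ω₀ - xav t = w k t - x k t := by
        simp only [hw, hv, hvav_eq, cross3_sub_left]
        abel
      have hself : cross3 (x k t) (x k t) = 0 := by simp [cross3]
      rw [hfeedback, cross3_sub_left (w k t), hself, sub_zero, cross3_add_left]
  have hv' : ∀ k, ∀ t : ℝ, 0 ≤ t → HasDerivAt (v k) (p k t) t := fun k t ht => by
    have h := (hx' k t ht).add ((hr k t ht).cross3 (hasDerivAt_const t ω₀))
    have hvk : v k = x k + fun s => cross3 (r k s) ω₀ := funext (hv k)
    rw [hvk]
    refine h.congr_deriv ?_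
    have hanti : cross3 ω₀ (x k t) = -cross3 (x k t) ω₀ := (cross_anticomm _ _).symm
    have hzero : cross3 (r k t) 0 = 0 := by simp [cross3]
    rw [hanti, hzero]
    abel
  have hw' : ∀ k, ∀ t : ℝ, 0 ≤ t →
      HasDerivAt (w k) (p k t - (N : ℝ)⁻¹ • ∑ j, p j t) t := fun k t ht => by
    refine (hv' k t ht).sub ?_
    rw [funext hvav]
    exact (HasDerivAt.fun_sum fun j _ => hv' j t ht).fun_const_smul _
  have hwsum : ∀ t, ∑ k, w k t = 0 := fun t => by
    simp only [hw, Finset.sum_sub_distrib, hvav, Finset.sum_const, Finset.card_univ,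
      Fintype.card_fin]
    rw [← Nat.cast_smul_eq_nsmul ℝ, smul_smul, mul_inv_cancel₀ hNne, one_smul, sub_self]
  set S : ℝ → ℝ := fun t => ∑ k, w k t ⬝ᵥ w k t
  set S' : ℝ → ℝ := fun t => -2 * ∑ k, cross3 (w k t) (x k t) ⬝ᵥ cross3 (w k t) (x k t) with hS'def
  have hS : ∀ t, 0 ≤ t → HasDerivAt S (S' t) t := fun t ht => by
    refine (HasDerivAt.fun_sum (u := Finset.univ)
      fun k _ => (hw' k t ht).dotProduct_self_s11).congr_deriv ?_
    simp only [dotProduct_sub, ← Finset.mul_sum, Finset.sum_sub_distrib, ← sum_dotProduct, hwsum,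
      zero_dotProduct, sub_zero, hp, dotProduct_cross3_cross3_s11, Finset.sum_neg_distrib, hS'def]
    ring
  have hS'le : ∀ k t, S' t ≤ -(cross3 (w k t) (x k t) ⬝ᵥ cross3 (w k t) (x k t)) := fun k t => by
    have h := Finset.single_le_sum
      (f := fun j => cross3 (w j t) (x j t) ⬝ᵥ cross3 (w j t) (x j t))
      (fun j _ => dotProduct_self_nonneg_real _) (Finset.mem_univ k)
    have h₀ := dotProduct_self_nonneg_real (cross3 (w k t) (x k t))
    simp only [hS'def]
    linarith
  have hSanti : ∀ t, 0 ≤ t → S t ≤ S 0 := fun t ht => by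
    have hanti : AntitoneOn S (Set.Ici 0) := antitoneOn_of_deriv_nonpos (convex_Ici 0)
      (fun s hs => (hS s hs).continuousAt.continuousWithinAt)
      (fun s hs => (hS s (interior_subset hs)).differentiableAt.differentiableWithinAt)
      (fun s hs => by
        rw [(hS s (interior_subset hs)).deriv]
        exact (hS'le ⟨0, hN⟩ s).trans (neg_nonpos.2 (dotProduct_self_nonneg_real _)))
    exact hanti Set.self_mem_Ici ht ht
  have hxnorm : ∀ k, ∀ t : ℝ, 0 ≤ t → ‖x k t‖ ≤ 1 := fun k t ht => by
    simpa [hxself k t ht] using norm_le_sqrt_dotProduct_self (x k t)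
  obtain ⟨M, hM0, hM⟩ : ∃ M, 0 ≤ M ∧ ∀ k, ∀ t : ℝ, 0 ≤ t → ‖w k t‖ ≤ M :=
    ⟨√(S 0), Real.sqrt_nonneg _, fun k t ht =>
      (norm_le_sqrt_dotProduct_self _).trans <| Real.sqrt_le_sqrt <|
        (Finset.single_le_sum (f := fun j => w j t ⬝ᵥ w j t)
          (fun j _ => dotProduct_self_nonneg_real _) (Finset.mem_univ k)).trans (hSanti t ht)⟩
  have hcross : ∀ {a b : Fin 3 → ℝ} {A B : ℝ}, ‖a‖ ≤ A → ‖b‖ ≤ B →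
      ‖cross3 a b‖ ≤ 2 * A * B := fun {a b A B} ha hb => by
    have hA := (norm_nonneg a).trans ha
    exact (norm_cross3_le a b).trans (by gcongr)
  have hynorm : ∀ k, ∀ t : ℝ, 0 ≤ t → ‖cross3 (w k t) (x k t)‖ ≤ 2 * M * 1 := fun k t ht =>
    hcross (hM k t ht) (hxnorm k t ht)
  have hpnorm : ∀ k, ∀ t : ℝ, 0 ≤ t → ‖p k t‖ ≤ 2 * (2 * M * 1) * 1 := fun k t ht =>
    hcross (hynorm k t ht) (hxnorm k t ht)
  obtain ⟨D, hD⟩ : ∃ D, ∀ k, ∀ t : ℝ, 0 ≤ t → ‖p k t - (N : ℝ)⁻¹ • ∑ j, p j t‖ ≤ D := by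
    refine ⟨2 * (2 * M * 1) * 1 + ‖(N : ℝ)⁻¹‖ * ∑ _j : Fin N, 2 * (2 * M * 1) * 1,
      fun k t ht => (norm_sub_le _ _).trans (add_le_add (hpnorm k t ht) ?_)⟩
    rw [norm_smul]
    gcongr
    exact norm_sum_le_of_le _ fun j _ => hpnorm j t ht
  obtain ⟨E, hE⟩ : ∃ E, ∀ k, ∀ t : ℝ, 0 ≤ t → ‖cross3 ω₀ (x k t) + p k t‖ ≤ E :=
    ⟨2 * ‖ω₀‖ * 1 + 2 * (2 * M * 1) * 1, fun k t ht =>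
      norm_add_le_of_le (hcross le_rfl (hxnorm k t ht)) (hpnorm k t ht)⟩
  intro k
  have hlim : Tendsto (fun t => cross3 (w k t) (x k t) ⬝ᵥ cross3 (w k t) (x k t)) atTop
      (nhds 0) := by
    refine tendsto_zero_of_hasDerivAt_le_neg
      (C := 2 * (3 * (2 * M * 1) * (2 * D * 1 + 2 * M * E))) hS
      (fun t _ => Finset.sum_nonneg fun j _ => dotProduct_self_nonneg_real _)
      (fun t _ => hS'le k t) (fun t _ => dotProduct_self_nonneg_real _)
      (fun t ht => ((hw' k t ht).cross3 (hx' k t ht)).dotProduct_self_s11) fun t ht => ?_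
    rw [abs_mul, abs_two]
    have hy' := norm_add_le_of_le (hcross (hD k t ht) (hxnorm k t ht))
      (hcross (hM k t ht) (hE k t ht))
    refine mul_le_mul_of_nonneg_left ((abs_dotProduct_le _ _).trans ?_) zero_le_two
    exact mul_le_mul (by linarith [hynorm k t ht]) hy' (norm_nonneg _) (by linarith)
  refine squeeze_zero_norm (fun t => norm_le_sqrt_dotProduct_self _) ?_
  simpa using hlim.sqrt
end
end

section
/- Let N ≥ 1, d ≥ 1, let a_{kj} : [0, ∞) → ℝ (for 1 ≤ k, j ≤ N) be continuous with a_{kj}(t) ≥ 0 for all t, and let p_1, …, p_N : [0, ∞) → ℝ^d be C¹ functions satisfying the consensus dynamics ṗ_k(t) = ∑_{j=1}^N a_{kj}(t) ( p_j(t) − p_k(t) ). Then for every c ∈ ℝ^d the function t ↦ max_{1 ≤ k ≤ N} ⟨c, p_k(t)⟩ is nonincreasing on [0, ∞). Consequently, for all 0 ≤ s ≤ t, each p_k(t) lies in the (closed) convex hull of {p_1(s), …, p_N(s)}; that is, the convex hull of the states is non-expanding along solutions. -/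
open Filter

noncomputable section

open Set Topology

/-- Maximum principle for the scalar consensus dynamics: an upper bound for all agents at time `s`
remains an upper bound at all later times. -/
theorem le_of_consensus_scalar {ι : Type*} [Fintype ι] {a : ι → ι → ℝ → ℝ} {x : ι → ℝ → ℝ}
    {s M : ℝ} (ha : ∀ k j, ∀ t, s ≤ t → 0 ≤ a k j t)
    (hx : ∀ k, ∀ t, s ≤ t → HasDerivAt (x k) (∑ j, a k j t * (x j t - x k t)) t)
    (hM : ∀ k, x k s ≤ M) {t : ℝ} (hst : s ≤ t) (k : ι) : x k t ≤ M := by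
  -- The barrier `M + ε (τ - s)` cannot be crossed, for any slope `ε > 0`.
  have barrier : ∀ ε > 0, ∀ τ ∈ Icc s t, ∀ k, x k τ - ε * (τ - s) ≤ M := by
    intro ε hε
    have hderiv : ∀ k, ∀ τ, s ≤ τ → HasDerivAt (fun τ => x k τ - ε * (τ - s))
        ((∑ j, a k j τ * (x j τ - x k τ)) - ε) τ := fun k τ hτ => by
      simpa [Pi.sub_def] using (hx k τ hτ).sub (((hasDerivAt_id τ).sub_const s).const_mul ε)
    refine IsClosed.Icc_subset_of_forall_mem_nhdsWithin
      (s := {τ | ∀ k, x k τ - ε * (τ - s) ≤ M}) ?_ (by simpa using hM) ?_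
    · have hset : {τ | ∀ k, x k τ - ε * (τ - s) ≤ M} ∩ Icc s t =
          Icc s t ∩ (fun τ k => x k τ - ε * (τ - s)) ⁻¹' Iic (fun _ => M) := by
        ext τ
        simp [Pi.le_def, and_comm]
      rw [hset]
      exact ContinuousOn.preimage_isClosed_of_isClosed
        (continuousOn_pi.2 fun k τ hτ => (hderiv k τ hτ.1).continuousAt.continuousWithinAt)
        isClosed_Icc isClosed_Iic
    · rintro τ ⟨hτM, hτ⟩
      refine eventually_all.2 fun k => ?_
      rcases (hτM k).lt_or_eq with hlt | heq
      · filter_upwards [((hderiv k τ hτ.1).continuousAt.tendsto.eventually_lt_const hlt).filter_mono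
          nhdsWithin_le_nhds] with z hz using hz.le
      · have hneg : (∑ j, a k j τ * (x j τ - x k τ)) - ε < 0 := by
          have : ∑ j, a k j τ * (x j τ - x k τ) ≤ 0 := Finset.sum_nonpos fun j _ =>
            mul_nonpos_of_nonneg_of_nonpos (ha k j τ hτ.1) (by linarith [hτM j])
          linarith
        filter_upwards [(hderiv k τ hτ.1).hasDerivWithinAt.limsup_slope_le' self_notMem_Ioi hneg,
          self_mem_nhdsWithin] with z hz hτz
        rw [slope_def_field, div_neg_iff] at hz
        have : τ < z := hτz
        rcases hz with hz | hz <;> linarith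
  refine le_of_forall_pos_le_add fun δ hδ => ?_
  have hpos : 0 < t - s + 1 := by linarith
  have h := barrier (δ / (t - s + 1)) (by positivity) t ⟨hst, le_rfl⟩ k
  have : δ / (t - s + 1) * (t - s) ≤ δ := by
    rw [div_mul_eq_mul_div, div_le_iff₀ hpos]
    nlinarith
  linarith

/-- Along the consensus dynamics in a normed space, a bound on a continuous linear functional at
all agents is preserved forward in time. -/
theorem apply_le_of_consensus {ι E : Type*} [Fintype ι] [NormedAddCommGroup E] [NormedSpace ℝ E]
    {a : ι → ι → ℝ → ℝ} {p : ι → ℝ → E} {s M : ℝ} (ha : ∀ k j, ∀ t, s ≤ t → 0 ≤ a k j t)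
    (hp : ∀ k, ∀ t, s ≤ t → HasDerivAt (p k) (∑ j, a k j t • (p j t - p k t)) t)
    (f : StrongDual ℝ E) (hM : ∀ k, f (p k s) ≤ M) {t : ℝ} (hst : s ≤ t) (k : ι) :
    f (p k t) ≤ M :=
  le_of_consensus_scalar (x := fun k t => f (p k t)) ha
    (fun k t ht => by simpa [Function.comp_def] using f.hasFDerivAt.comp_hasDerivAt t (hp k t ht))
    hM hst k

/-- For the time-varying linear consensus dynamics
`ṗ_k = ∑_j a_{kj}(t)(p_j − p_k)` with nonnegative continuous weights, for every `c ∈ ℝ^d` the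
function `t ↦ max_k ⟨c, p_k(t)⟩` is nonincreasing on `[0, ∞)`; consequently each `p_k(t)` lies
in the convex hull of `{p_1(s), …, p_N(s)}` for all `0 ≤ s ≤ t`: the convex hull of the states
is non-expanding along solutions. -/
theorem consensus_convex_hull_nonexpanding
    (N d : ℕ) (hN : 1 ≤ N) (hd : 1 ≤ d)
    (a : Fin N → Fin N → ℝ → ℝ)
    (hacont : ∀ k j, Continuous (a k j))
    (hapos : ∀ k j, ∀ t : ℝ, 0 ≤ t → 0 ≤ a k j t)
    (p : Fin N → ℝ → Fin d → ℝ)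
    (hdyn : ∀ k, ∀ t : ℝ, 0 ≤ t →
      HasDerivAt (p k) (∑ j, a k j t • (p j t - p k t)) t) :
    (∀ c : Fin d → ℝ,
      AntitoneOn (fun t => ⨆ k, ∑ i, c i * p k t i) (Set.Ici (0 : ℝ))) ∧
    (∀ s t : ℝ, 0 ≤ s → s ≤ t → ∀ k,
      p k t ∈ convexHull ℝ (Set.range fun j => p j s)) := by
  have hbound : ∀ s t : ℝ, 0 ≤ s → s ≤ t → ∀ (f : StrongDual ℝ (Fin d → ℝ)) (M : ℝ),
      (∀ k, f (p k s) ≤ M) → ∀ k, f (p k t) ≤ M := fun s t hs hst f M hM k =>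
    apply_le_of_consensus (fun k j t ht => hapos k j t (hs.trans ht))
      (fun k t ht => hdyn k t (hs.trans ht)) f hM hst k
  refine ⟨fun c s hs t _ hst => ?_, fun s t hs hst k => ?_⟩
  · have : Nonempty (Fin N) := ⟨⟨0, hN⟩⟩
    let f : StrongDual ℝ (Fin d → ℝ) := ∑ i, c i • ContinuousLinearMap.proj i
    have hf : ∀ v, f v = ∑ i, c i * v i := fun v => by simp [f]
    simp only [← hf]
    exact ciSup_le (hbound s t hs hst f _ fun k =>
      le_ciSup (f := fun k => f (p k s)) (finite_range _).bddAbove k)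
  · by_contra hk
    obtain ⟨f, u, hu, huk⟩ := geometric_hahn_banach_closed_point (convex_convexHull ℝ _)
      ((finite_range fun j => p j s).isClosed_convexHull ℝ) hk
    exact huk.not_ge <| hbound s t hs hst f u
      (fun j => (hu _ (subset_convexHull ℝ _ (mem_range_self j))).le) k
end
end
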